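/- arXiv:2603.29011 — 2 statements merged into one kernel-verified Lean document; each statement's English description precedes it below -/
import Mathlib

section
/- Let (X,d) be a finite metric space, m ∈ ℕ, and C < ∞. If X admits a weak C-biLipschitz embedding into the Euclidean space ℝ^m, then the metric space (La(X), TSCP + ρ) admits a weak C'-biLipschitz embedding into the ℓ∞-product of 3m ℝ-trees, where C' < ∞ depends only on C and m. -/
open Metric Set
open scoped Classical ENNReal NNReal

noncomputable section

/-- The underlying set of the lamplighter space over `X`: a lamp configuration
(a finite set of lit lamps) together with the position of the lamplighter. -/
abbrev Lamp (X : Type*) := Finset X × X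

namespace Lamplighter

variable {X Y Z : Type*}

/-- The length of the path visiting the points of a list in order,
with respect to the distance function `d`. -/
def pathLength (d : X → X → ℝ) : List X → ℝ
  | [] => 0
  | [_] => 0
  | x :: y :: l => d x y + pathLength d (y :: l)

/-- The symmetric difference of the lamp configurations of `p` and `q`, as a set. -/
def sd (p q : Lamp X) : Set X :=
  ((p.1 : Set X) \ (q.1 : Set X)) ∪ ((q.1 : Set X) \ (p.1 : Set X))

/-- The traveling salesman semimetric on the lamplighter space:
the infimum of lengths of finite paths starting at `p.2`, ending at `q.2`, and
visiting every point of the symmetric difference of the configurations. -/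
def TSP (d : X → X → ℝ) (p q : Lamp X) : ℝ :=
  sInf { s : ℝ | ∃ l : List X, l.head? = some p.2 ∧ l.getLast? = some q.2 ∧
    (∀ a ∈ sd p q, a ∈ l) ∧ s = pathLength d l }

/-- The diameter (in `ℝ≥0∞`) of a set with respect to a distance function `d`. -/
def ediamD (d : X → X → ℝ) (A : Set X) : ℝ≥0∞ :=
  ⨆ x ∈ A, ⨆ y ∈ A, ENNReal.ofReal (d x y)

/-- The traveling salesman shortcut semimetric:
`TSCP((A,x),(B,y)) = diam({x,y} ∪ (A Δ B))`. -/
def TSCP (d : X → X → ℝ) (p q : Lamp X) : ℝ :=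
  (ediamD d ({p.2, q.2} ∪ sd p q)).toReal

/-- `ρ((A,x),(B,y))` is `0` if `A = B` and `1` otherwise. -/
def rho (p q : Lamp X) : ℝ := if p.1 = q.1 then 0 else 1

/-- The lamplighter metric `d_La = TSP + ρ`. -/
def dLa (d : X → X → ℝ) (p q : Lamp X) : ℝ := TSP d p q + rho p q

/-- `X` is `K`-TSP-efficient if `TSP ≤ K • TSCP` on `La(X)²`. -/
def TSPEfficient (d : X → X → ℝ) (K : ℝ) : Prop :=
  ∀ p q : Lamp X, TSP d p q ≤ K * TSCP d p q

/-- A weak `C`-biLipschitz embedding between spaces with distance functions `dY`, `dZ`: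
a family of maps `φ t : Y → Z` (for `t > 0`) such that each `φ t` is `σ t`-Lipschitz
and `dY x y ≥ C*t` implies `dZ (φ t x) (φ t y) ≥ t * σ t`. -/
def WeakBiLip (dY : Y → Y → ℝ) (dZ : Z → Z → ℝ) (C : ℝ) : Prop :=
  ∃ φ : ℝ → Y → Z, ∀ t : ℝ, 0 < t → ∃ σ : ℝ, 0 < σ ∧
    (∀ x y : Y, dZ (φ t x) (φ t y) ≤ σ * dY x y) ∧
    (∀ x y : Y, C * t ≤ dY x y → t * σ ≤ dZ (φ t x) (φ t y))

/-- `f` is a `C`-biLipschitz embedding (an injective map of biLipschitz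
distortion at most `C`, allowing an overall scaling factor `s`). -/
def BiLipWith (dY : Y → Y → ℝ) (dZ : Z → Z → ℝ) (C : ℝ) (f : Y → Z) : Prop :=
  Function.Injective f ∧ ∃ s : ℝ, 0 < s ∧
    ∀ x y : Y, s * dY x y ≤ dZ (f x) (f y) ∧ dZ (f x) (f y) ≤ C * s * dY x y

/-- Nagata dimension at most `n` with constant at most `γ`: for every scale `s > 0`
there is a covering by sets of diameter at most `γ s` such that every set of diameter
less than `s` meets at most `n + 1` members of the covering. -/
def NagataDimD (d : Y → Y → ℝ) (n : ℕ) (γ : ℝ) : Prop :=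
  ∀ s : ℝ, 0 < s → ∃ B : Set (Set Y),
    (∀ y : Y, ∃ b ∈ B, y ∈ b) ∧
    (∀ b ∈ B, ediamD d b ≤ ENNReal.ofReal (γ * s)) ∧
    (∀ A : Set Y, ediamD d A < ENNReal.ofReal s →
      {b | b ∈ B ∧ (b ∩ A).Nonempty}.encard ≤ ((n : ℕ∞) + 1))

/-- Markov type 2 with constant `M`, for the distance function `d`: for every stationary
reversible Markov chain on a finite state space (given by a stationary distribution `μ`
and a reversible stochastic transition matrix `P`), every map `f` into the space, and
every time `t`, `E[d(f(Z_t),f(Z_0))²] ≤ M² t E[d(f(Z_1),f(Z_0))²]`. -/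
def HasMarkovType2 (d : Y → Y → ℝ) (M : ℝ) : Prop :=
  ∀ (n : ℕ) (μ : Fin n → ℝ) (P : Matrix (Fin n) (Fin n) ℝ),
    (∀ i, 0 ≤ μ i) → (∑ i, μ i) = 1 →
    (∀ i j, 0 ≤ P i j) → (∀ i, (∑ j, P i j) = 1) →
    (∀ i j, μ i * P i j = μ j * P j i) →
    ∀ (f : Fin n → Y) (t : ℕ),
      (∑ i, ∑ j, μ i * (P ^ t) i j * d (f i) (f j) ^ 2) ≤
        M ^ 2 * t * ∑ i, ∑ j, μ i * P i j * d (f i) (f j) ^ 2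

/-- `D`-doubling: every ball of radius `r` can be covered by `D` balls of radius `r/2`. -/
def Doubling (d : Y → Y → ℝ) (D : ℕ) : Prop :=
  ∀ r : ℝ, 0 < r → ∀ x : Y, ∃ c : Fin D → Y,
    ∀ y : Y, d x y ≤ r → ∃ i, d (c i) y ≤ r / 2

/-- `A` is an arc from `x` to `y`: the image of an injective continuous map of `[0,1]`
sending the endpoints to `x` and `y`. -/
def IsArc {T : Type*} [MetricSpace T] (x y : T) (A : Set T) : Prop :=
  ∃ γ : ℝ → T, ContinuousOn γ (Icc 0 1) ∧ InjOn γ (Icc 0 1) ∧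
    γ 0 = x ∧ γ 1 = y ∧ γ '' (Icc 0 1) = A

/-- `A` is a geodesic segment from `x` to `y`: the image of an isometric embedding
of `[0, dist x y]` sending the endpoints to `x` and `y`. -/
def IsGeodesicSeg {T : Type*} [MetricSpace T] (x y : T) (A : Set T) : Prop :=
  ∃ γ : ℝ → T, γ 0 = x ∧ γ (dist x y) = y ∧
    (∀ s ∈ Icc (0 : ℝ) (dist x y), ∀ t ∈ Icc (0 : ℝ) (dist x y),
      dist (γ s) (γ t) = |s - t|) ∧
    γ '' (Icc 0 (dist x y)) = A

/-- `T` is an ℝ-tree: any two (distinct) points are joined by a unique arc,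
and this arc is a geodesic. -/
def IsRTree (T : Type*) [MetricSpace T] : Prop :=
  ∀ x y : T, x ≠ y →
    (∃ A : Set T, IsArc x y A) ∧
    (∀ A A' : Set T, IsArc x y A → IsArc x y A' → A = A') ∧
    (∀ A : Set T, IsArc x y A → IsGeodesicSeg x y A)

/-- The sup (ℓ∞-product) distance on a finite product of metric spaces. -/
def piSupDist {n : ℕ} {T : Fin n → Type*} (I : ∀ i, MetricSpace (T i)) :
    (∀ i, T i) → (∀ i, T i) → ℝ :=
  letI := I
  fun f g => dist f g

/-- The ℓ1-product distance on a finite product of metric spaces. -/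
def piL1Dist {n : ℕ} {T : Fin n → Type*} (I : ∀ i, MetricSpace (T i)) :
    (∀ i, T i) → (∀ i, T i) → ℝ :=
  letI := I
  fun f g => ∑ i, dist (f i) (g i)

/-- The ℓ1 distance on `ℝ^m`. -/
def l1Dist (m : ℕ) (x y : Fin m → ℝ) : ℝ := ∑ i, |x i - y i|

/-- The ℓp distance on `ℝ^m`. -/
def lpDist (m : ℕ) (p : ℝ) (x y : Fin m → ℝ) : ℝ :=
  (∑ i, |x i - y i| ^ p) ^ (1 / p)

/-- The (pseudo)distance of the ℝ-star over the index type `ι`: the wedge sum of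
copies of `[0,∞)` indexed by `ι`, glued at `0`. -/
def starDist {ι : Type*} (p q : ι × ℝ≥0) : ℝ :=
  if p.1 = q.1 then |(p.2 : ℝ) - (q.2 : ℝ)| else (p.2 : ℝ) + (q.2 : ℝ)

/-- The sup (ℓ∞-product) of finitely many distance functions. -/
def supD {n : ℕ} {T : Fin n → Type*} (d : ∀ i, T i → T i → ℝ) (f g : ∀ i, T i) : ℝ :=
  ((Finset.univ.sup fun i => (d i (f i) (g i)).toNNReal : ℝ≥0) : ℝ)

/-- The infimum of distortions of biLipschitz embeddings of `(Y, dY)` into `(Z, dZ)`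
(`∞` if there is no such embedding). -/
def cEmb (dY : Y → Y → ℝ) (dZ : Z → Z → ℝ) : ℝ≥0∞ :=
  sInf { D : ℝ≥0∞ | ∃ C : ℝ, 0 < C ∧ D = ENNReal.ofReal C ∧
    ∃ f : Y → Z, BiLipWith dY dZ C f }

/-- `c_1^{m,dom}(X,d)`: the infimum of all `D > 0` such that there exist injective
`1`-Lipschitz maps `φ i : X → ℝ` and weights `α i ≥ 0` summing to `1` with
`∑ i, α i * |φ i x - φ i y| ≥ d x y / D` for all `x y` (`∞` if there is none). -/
def c1dom (d : X → X → ℝ) (m : ℕ) : ℝ≥0∞ :=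
  sInf { D : ℝ≥0∞ | ∃ C : ℝ, 0 < C ∧ D = ENNReal.ofReal C ∧
    ∃ (φ : Fin m → X → ℝ) (α : Fin m → ℝ),
      (∀ i, Function.Injective (φ i)) ∧
      (∀ i, ∀ x y : X, |φ i x - φ i y| ≤ d x y) ∧
      (∀ i, 0 ≤ α i) ∧ (∑ i, α i) = 1 ∧
      ∀ x y : X, d x y / C ≤ ∑ i, α i * |φ i x - φ i y| }

/-- The Hamming distance on the Hamming cube `{0,1}^M`, as a real number. -/
def hamDist {M : ℕ} (x y : Fin M → Bool) : ℝ :=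
  ((Finset.univ.filter fun i => x i ≠ y i).card : ℝ)

/-- The star graph `St_{n,k}`: the one-point coalescence of `n` paths of length `k`,
realized inside `ℤ^n` as the multiples `α eᵢ` with `0 ≤ α ≤ k`. -/
def St (n k : ℕ) : Type :=
  {x : Fin n → ℤ // ∃ i : Fin n, (∀ j : Fin n, j ≠ i → x j = 0) ∧ 0 ≤ x i ∧ x i ≤ (k : ℤ)}

/-- The ℓ1 metric on the star graph `St_{n,k}`. -/
def stDist {n k : ℕ} (x y : St n k) : ℝ := ∑ j, |(x.1 j : ℝ) - (y.1 j : ℝ)|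

/-- The endpoint `k eᵢ` of the `i`-th branch of the star graph. -/
def St.endpoint {n k : ℕ} (i : Fin n) : St n k :=
  ⟨fun j => if j = i then (k : ℤ) else 0, i, fun j hj => if_neg hj, by simp, by simp⟩

/-- The cycle metric on `ℤ/nℤ`. -/
def cycDist {n : ℕ} (a b : ZMod n) : ℝ := ((min ((a - b).val) ((b - a).val) : ℕ) : ℝ)

/-- The rectangular grid `G_{k,n} = ([0,k] ∩ ℤ) × ([0,n] ∩ ℤ)`. -/
def Grid2 (k n : ℕ) : Type :=
  {p : ℤ × ℤ // 0 ≤ p.1 ∧ p.1 ≤ (k : ℤ) ∧ 0 ≤ p.2 ∧ p.2 ≤ (n : ℤ)}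

/-- The ℓ1 metric on the grid `G_{k,n}`. -/
def grid2Dist {k n : ℕ} (x y : Grid2 k n) : ℝ :=
  |(x.1.1 : ℝ) - (y.1.1 : ℝ)| + |(x.1.2 : ℝ) - (y.1.2 : ℝ)|

/-- The `m`-dimensional grid `G^m({n_i}) = ∏ i, ([0, n_i] ∩ ℤ)`. -/
def GridM (m : ℕ) (n : Fin m → ℕ) : Type :=
  {p : Fin m → ℤ // ∀ i, 0 ≤ p i ∧ p i ≤ (n i : ℤ)}

/-- The ℓ1 metric on the `m`-dimensional grid. -/
def gridMDist {m : ℕ} {n : Fin m → ℕ} (x y : GridM m n) : ℝ :=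
  ∑ i, |(x.1 i : ℝ) - (y.1 i : ℝ)|

/-- A point of the universal tree with branches labelled by `L`: a height together with
a labelling of the half-line above it which is eventually trivial. -/
@[ext]
structure BranchTree (L : Type*) [Inhabited L] where
  /-- The height of the point. -/
  height : ℝ
  /-- The labelling, extended trivially below the point. -/
  label : ℝ → L
  label_below : ∀ r ≤ height, label r = default
  label_above : ∃ R, ∀ r > R, label r = default

namespace BranchTree

variable {L : Type*} [Inhabited L]

/-- The height at which the upward rays from `p` and `q` merge. -/
def meet (p q : BranchTree L) : ℝ :=
  sInf {r | p.height ≤ r ∧ q.height ≤ r ∧ ∀ w > r, p.label w = q.label w}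

theorem meet_le_iff {p q : BranchTree L} {r : ℝ} :
    meet p q ≤ r ↔ p.height ≤ r ∧ q.height ≤ r ∧ ∀ w > r, p.label w = q.label w := by
  set S := {r | p.height ≤ r ∧ q.height ≤ r ∧ ∀ w > r, p.label w = q.label w}
  have hbdd : BddBelow S := ⟨p.height, fun r hr => hr.1⟩
  have hne : S.Nonempty := by
    obtain ⟨R, hR⟩ := p.label_above
    obtain ⟨R', hR'⟩ := q.label_above
    refine ⟨max (max p.height q.height) (max R R'), by simp, by simp, fun w hw => ?_⟩
    simp only [gt_iff_lt, max_lt_iff] at hw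
    rw [hR w hw.2.1, hR' w hw.2.2]
  constructor
  · intro h
    refine ⟨le_trans (le_csInf hne fun r hr => hr.1) h,
      le_trans (le_csInf hne fun r hr => hr.2.1) h, fun w hw => ?_⟩
    obtain ⟨r', hr', hlt⟩ := exists_lt_of_csInf_lt hne (lt_of_le_of_lt h hw)
    exact hr'.2.2 w hlt
  · exact fun h => csInf_le hbdd h

theorem height_le_meet_left (p q : BranchTree L) : p.height ≤ meet p q :=
  (meet_le_iff.1 le_rfl).1

theorem height_le_meet_right (p q : BranchTree L) : q.height ≤ meet p q :=
  (meet_le_iff.1 le_rfl).2.1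

theorem meet_self (p : BranchTree L) : meet p p = p.height :=
  le_antisymm (meet_le_iff.2 ⟨le_rfl, le_rfl, fun _ _ => rfl⟩) (height_le_meet_left p p)

theorem meet_comm (p q : BranchTree L) : meet p q = meet q p := by
  refine eq_of_forall_ge_iff fun r => ?_
  rw [meet_le_iff, meet_le_iff]
  exact ⟨fun h => ⟨h.2.1, h.1, fun w hw => (h.2.2 w hw).symm⟩,
    fun h => ⟨h.2.1, h.1, fun w hw => (h.2.2 w hw).symm⟩⟩

theorem meet_le_max (p q r : BranchTree L) : meet p r ≤ max (meet p q) (meet q r) := by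
  have h₁ := meet_le_iff.1 (le_max_left (meet p q) (meet q r))
  have h₂ := meet_le_iff.1 (le_max_right (meet p q) (meet q r))
  exact meet_le_iff.2 ⟨h₁.1, h₂.2.1, fun w hw => (h₁.2.2 w hw).trans (h₂.2.2 w hw)⟩

theorem eq_of_meet_le {p q : BranchTree L} (hp : meet p q ≤ p.height)
    (hq : meet p q ≤ q.height) : p = q := by
  have hpq : p.height = q.height := le_antisymm (meet_le_iff.1 hq).1 (meet_le_iff.1 hp).2.1
  refine BranchTree.ext hpq (funext fun w => ?_)
  rcases le_or_gt w p.height with hw | hw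
  · rw [p.label_below w hw, q.label_below w (hpq ▸ hw)]
  · exact (meet_le_iff.1 hp).2.2 w hw

instance : MetricSpace (BranchTree L) where
  dist p q := 2 * meet p q - p.height - q.height
  dist_self p := by rw [meet_self]; ring
  dist_comm p q := by rw [meet_comm]; ring
  dist_triangle p q r := by
    have h₁ := height_le_meet_right p q
    have h₂ := height_le_meet_left q r
    rcases le_max_iff.1 (meet_le_max p q r) with h | h <;> linarith
  eq_of_dist_eq_zero {p q} h := by
    replace h : 2 * meet p q - p.height - q.height = 0 := h
    have h₁ := height_le_meet_left p q
    have h₂ := height_le_meet_right p q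
    exact eq_of_meet_le (by linarith) (by linarith)

theorem dist_eq (p q : BranchTree L) : dist p q = 2 * meet p q - p.height - q.height := rfl

theorem continuous_height : Continuous (height : BranchTree L → ℝ) := by
  refine (LipschitzWith.of_dist_le_mul (K := 1) fun p q => ?_).continuous
  have h₁ := height_le_meet_left p q
  have h₂ := height_le_meet_right p q
  rw [Real.dist_eq, abs_le, dist_eq]
  constructor <;> push_cast <;> linarith

theorem continuous_meet_left (x : BranchTree L) : Continuous fun p => meet p x := by
  have h : (fun p => meet p x) = fun p => (dist p x + p.height + x.height) / 2 := by
    funext p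
    rw [dist_eq]
    ring
  rw [h]
  have := continuous_height (L := L)
  fun_prop

/-- The point of height `s` whose upward ray is labelled by `k`. -/
def truncate (k : ℝ → L) (hk : ∃ R, ∀ r > R, k r = default) (s : ℝ) : BranchTree L where
  height := s
  label w := if s < w then k w else default
  label_below r hr := if_neg (not_lt.2 hr)
  label_above := by
    obtain ⟨R, hR⟩ := hk
    refine ⟨R, fun r hr => ?_⟩
    rw [hR r hr, ite_self]

theorem meet_truncate_le_iff {k k' : ℝ → L} {hk : ∃ R, ∀ r > R, k r = default}
    {hk' : ∃ R, ∀ r > R, k' r = default} {s s' r : ℝ} :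
    meet (truncate k hk s) (truncate k' hk' s') ≤ r ↔
      s ≤ r ∧ s' ≤ r ∧ ∀ w > r, k w = k' w := by
  rw [meet_le_iff]
  refine and_congr_right fun hs => and_congr_right fun hs' => forall₂_congr fun w hw => ?_
  have h₁ : s < w := lt_of_le_of_lt hs hw
  have h₂ : s' < w := lt_of_le_of_lt hs' hw
  simp only [truncate, if_pos h₁, if_pos h₂]

/-- The point at height `u` on the upward ray from `p`. -/
def ascend (p : BranchTree L) (u : ℝ) : BranchTree L := truncate p.label p.label_above u

@[simp]
theorem height_ascend (p : BranchTree L) (u : ℝ) : (p.ascend u).height = u := rfl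

theorem meet_ascend {p : BranchTree L} {u : ℝ} (hu : p.height ≤ u) : meet p (p.ascend u) = u := by
  refine le_antisymm (meet_le_iff.2 ⟨hu, le_rfl, fun w hw => ?_⟩)
    (height_le_meet_right p (p.ascend u))
  simp only [ascend, truncate, if_pos hw]

theorem ascend_height (p : BranchTree L) : p.ascend p.height = p :=
  (eq_of_meet_le (meet_ascend le_rfl).le (meet_ascend le_rfl).le).symm

theorem dist_ascend_ascend {p : BranchTree L} {u v : ℝ} (hu : p.height ≤ u) (hv : p.height ≤ v) :
    dist (p.ascend u) (p.ascend v) = |u - v| := by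
  have h := meet_le_max (p.ascend u) p (p.ascend v)
  have h₁ := height_le_meet_left (p.ascend u) (p.ascend v)
  have h₂ := height_le_meet_right (p.ascend u) (p.ascend v)
  rw [meet_comm _ p, meet_ascend hu, meet_ascend hv] at h
  rw [height_ascend] at h₁ h₂
  rw [dist_eq, le_antisymm h (max_le h₁ h₂), height_ascend, height_ascend]
  rcases le_total u v with huv | huv
  · rw [max_eq_right huv, abs_of_nonpos (by linarith)]; ring
  · rw [max_eq_left huv, abs_of_nonneg (by linarith)]; ring

theorem dist_ascend_ascend_of_le {x y : BranchTree L} {u v : ℝ} (hu : x.height ≤ u)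
    (hu' : u ≤ meet x y) (hv : y.height ≤ v) (hv' : v ≤ meet x y) :
    dist (x.ascend u) (y.ascend v) = 2 * meet x y - u - v := by
  have hup : meet (x.ascend u) (y.ascend v) ≤ meet x y := by
    have h₁ := meet_le_max (x.ascend u) x (y.ascend v)
    have h₂ := meet_le_max x y (y.ascend v)
    rw [meet_comm _ x, meet_ascend hu] at h₁
    rw [meet_ascend hv, max_eq_left hv'] at h₂
    exact h₁.trans (max_le hu' h₂)
  have hlow : meet x y ≤ meet (x.ascend u) (y.ascend v) := by
    have h₁ := meet_le_max x (x.ascend u) y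
    have h₂ := meet_le_max (x.ascend u) (y.ascend v) y
    have h₃ := height_le_meet_left (x.ascend u) (y.ascend v)
    have h₄ := height_le_meet_right (x.ascend u) (y.ascend v)
    rw [meet_ascend hu] at h₁
    rw [meet_comm _ y, meet_comm _ y, meet_ascend hv, meet_comm y] at h₂
    exact h₁.trans (max_le h₃ (h₂.trans (max_le le_rfl h₄)))
  rw [dist_eq, le_antisymm hup hlow, height_ascend, height_ascend]

/-- The unit speed geodesic from `x` to `y`. -/
def geodesic (x y : BranchTree L) (τ : ℝ) : BranchTree L :=
  if τ ≤ meet x y - x.height then x.ascend (x.height + τ)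
  else y.ascend (y.height + (dist x y - τ))

theorem geodesic_zero (x y : BranchTree L) : geodesic x y 0 = x := by
  rw [geodesic, if_pos (sub_nonneg.2 (height_le_meet_left x y)), add_zero, ascend_height]

theorem dist_geodesic {x y : BranchTree L} {σ τ : ℝ} (hσ : σ ∈ Icc 0 (dist x y))
    (hτ : τ ∈ Icc 0 (dist x y)) : dist (geodesic x y σ) (geodesic x y τ) = |σ - τ| := by
  wlog hστ : σ ≤ τ generalizing σ τ
  · rw [dist_comm, this hτ hσ (le_of_not_ge hστ), abs_sub_comm]
  have hd := dist_eq x y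
  obtain ⟨hσ₀, hσ₁⟩ := hσ
  obtain ⟨hτ₀, hτ₁⟩ := hτ
  unfold geodesic
  split_ifs with h₁ h₂ h₂
  · rw [dist_ascend_ascend (by linarith) (by linarith)]
    congr 1
    ring
  · rw [dist_ascend_ascend_of_le (by linarith) (by linarith) (by linarith) (by linarith),
      abs_of_nonpos (by linarith)]
    linarith
  · linarith
  · rw [dist_ascend_ascend (by linarith) (by linarith), abs_sub_comm]
    congr 1
    ring

theorem geodesic_dist (x y : BranchTree L) : geodesic x y (dist x y) = y := by
  have hd := dist_eq x y
  have h := height_le_meet_right x y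
  have h' := height_le_meet_left x y
  unfold geodesic
  split_ifs with h₁
  · have hy : meet x y = y.height := by linarith
    refine (eq_of_meet_le ?_ ?_).symm
    · have h₂ := meet_le_max y x (x.ascend (x.height + dist x y))
      rw [meet_ascend (by linarith [dist_nonneg (x := x) (y := y)]), meet_comm y x] at h₂
      exact h₂.trans (max_le hy.le (by linarith))
    · have h₂ := meet_le_max y x (x.ascend (x.height + dist x y))
      rw [meet_ascend (by linarith [dist_nonneg (x := x) (y := y)]), meet_comm y x] at h₂
      rw [height_ascend]
      exact h₂.trans (max_le (by linarith) (by linarith))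
  · rw [sub_self, add_zero, ascend_height]

/-- A connected set containing `x` and `y` contains the part of the geodesic above `x`. -/
theorem ascend_mem_of_isPreconnected {A : Set (BranchTree L)} (hA : IsPreconnected A)
    {x y : BranchTree L} (hx : x ∈ A) (hy : y ∈ A) {u : ℝ} (hu : x.height < u)
    (hu' : u ≤ meet x y) : x.ascend u ∈ A := by
  by_contra hz
  let U : Set (BranchTree L) := {p | meet p x < u}
  let V : Set (BranchTree L) := {p | u < meet p x} ∪ ({p | u ≤ meet p x} ∩ {p | p.height < u})
  have hU : IsOpen U := isOpen_lt (continuous_meet_left x) continuous_const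
  have hV : IsOpen V := by
    rw [isOpen_iff_mem_nhds]
    rintro p (hp | ⟨hp, hp'⟩)
    · exact Filter.mem_of_superset
        ((isOpen_lt continuous_const (continuous_meet_left x)).mem_nhds hp) subset_union_left
    · have h₁ : ∀ᶠ q in nhds p, q.height < u :=
        (isOpen_lt continuous_height continuous_const).mem_nhds hp'
      have h₂ : ∀ᶠ q in nhds p, meet q p < u :=
        (isOpen_lt (continuous_meet_left p) continuous_const).mem_nhds
          (by simpa only [mem_ofPred_eq, meet_self] using hp')
      filter_upwards [h₁, h₂] with q hq₁ hq₂
      refine Or.inr ⟨?_, hq₁⟩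
      have h := meet_le_max p q x
      rw [meet_comm p q] at h
      rcases le_max_iff.1 h with h | h
      · exact absurd (lt_of_le_of_lt h hq₂) (not_lt.2 hp)
      · exact hp.trans h
  have hcover : A ⊆ U ∪ V := by
    intro p hp
    rcases lt_trichotomy (meet p x) u with h | h | h
    · exact Or.inl h
    · rcases (h ▸ height_le_meet_left p x : p.height ≤ u).lt_or_eq with h' | h'
      · exact Or.inr (Or.inr ⟨h.ge, h'⟩)
      · refine absurd ?_ hz
        have hm := meet_le_max p x (x.ascend u)
        rw [meet_ascend hu.le, h, max_self] at hm
        rwa [← eq_of_meet_le (hm.trans h'.ge) hm]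
    · exact Or.inr (Or.inl h)
  obtain ⟨p, -, hpU, hpV⟩ := hA U V hU hV hcover
    ⟨x, hx, show meet x x < u by rwa [meet_self]⟩
    ⟨y, hy, by
      rw [meet_comm] at hu'
      rcases hu'.lt_or_eq with h | h
      · exact Or.inl h
      · rcases (h ▸ height_le_meet_left y x : y.height ≤ u).lt_or_eq with h' | h'
        · exact Or.inr ⟨h.le, h'⟩
        · refine absurd ?_ hz
          have hm := meet_le_max y x (x.ascend u)
          rw [meet_ascend hu.le, ← h, max_self] at hm
          rwa [← eq_of_meet_le (hm.trans h'.ge) hm]⟩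
  rcases hpV with h | h
  · exact lt_asymm (show meet p x < u from hpU) h
  · exact not_lt.2 (show u ≤ meet p x from h.1) hpU

theorem geodesic_image_subset {A : Set (BranchTree L)} (hA : IsPreconnected A)
    {x y : BranchTree L} (hx : x ∈ A) (hy : y ∈ A) :
    geodesic x y '' Icc 0 (dist x y) ⊆ A := by
  rintro _ ⟨τ, ⟨hτ₀, hτ₁⟩, rfl⟩
  have hd := dist_eq x y
  unfold geodesic
  split_ifs with h
  · rcases hτ₀.eq_or_lt with rfl | h₀
    · rwa [add_zero, ascend_height]
    · exact ascend_mem_of_isPreconnected hA hx hy (by linarith) (by linarith)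
  · rcases hτ₁.eq_or_lt with rfl | h₁
    · rwa [sub_self, add_zero, ascend_height]
    · exact ascend_mem_of_isPreconnected hA hy hx (by linarith) (by rw [meet_comm]; linarith)

theorem continuousOn_geodesic (x y : BranchTree L) :
    ContinuousOn (geodesic x y) (Icc 0 (dist x y)) :=
  (LipschitzOnWith.of_dist_le_mul (K := 1) fun σ hσ τ hτ => by
    rw [dist_geodesic hσ hτ, NNReal.coe_one, one_mul, Real.dist_eq]).continuousOn

theorem isArc_geodesic {x y : BranchTree L} (hxy : x ≠ y) :
    IsArc x y (geodesic x y '' Icc 0 (dist x y)) := by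
  have hd : 0 < dist x y := dist_pos.2 hxy
  have hmaps : MapsTo (fun t => dist x y * t) (Icc (0 : ℝ) 1) (Icc 0 (dist x y)) :=
    fun t ht => ⟨mul_nonneg hd.le ht.1, mul_le_of_le_one_right hd.le ht.2⟩
  refine ⟨fun t => geodesic x y (dist x y * t), ?_, ?_, ?_, ?_, ?_⟩
  · exact (continuousOn_geodesic x y).comp (by fun_prop) hmaps
  · intro s hs t ht hst
    have h := dist_geodesic (hmaps hs) (hmaps ht)
    rw [show geodesic x y (dist x y * s) = geodesic x y (dist x y * t) from hst, dist_self] at h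
    exact mul_left_cancel₀ hd.ne' (sub_eq_zero.1 (abs_eq_zero.1 h.symm))
  · simp only [mul_zero, geodesic_zero]
  · simp only [mul_one, geodesic_dist]
  · refine Subset.antisymm (by rintro _ ⟨t, ht, rfl⟩; exact ⟨_, hmaps ht, rfl⟩) ?_
    rintro _ ⟨τ, hτ, rfl⟩
    refine ⟨τ / dist x y, ⟨div_nonneg hτ.1 hd.le, (div_le_one hd).2 hτ.2⟩, ?_⟩
    simp only [mul_div_cancel₀ τ hd.ne']

theorem eq_geodesic_image_of_isArc {x y : BranchTree L} {A : Set (BranchTree L)}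
    (hA : IsArc x y A) : A = geodesic x y '' Icc 0 (dist x y) := by
  obtain ⟨γ, hγc, hγi, hγ₀, hγ₁, rfl⟩ := hA
  have h₀ : (0 : ℝ) ∈ Icc (0 : ℝ) 1 := ⟨le_rfl, zero_le_one⟩
  have h₁ : (1 : ℝ) ∈ Icc (0 : ℝ) 1 := ⟨zero_le_one, le_rfl⟩
  have hsub := geodesic_image_subset (isPreconnected_Icc.image γ hγc)
    ⟨0, h₀, hγ₀⟩ ⟨1, h₁, hγ₁⟩
  refine Subset.antisymm ?_ hsub
  have hcont : Continuous ((Icc (0 : ℝ) 1).domRestrict γ) := hγc.domRestrict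
  have hpre := (isPreconnected_Icc.image _ (continuousOn_geodesic x y)).preimage_of_isClosedMap
    hγi.injective hcont.isClosedMap (by rwa [range_domRestrict])
  have hdist : (0 : ℝ) ≤ dist x y := dist_nonneg
  have hIcc := hpre.Icc_subset (a := ⟨0, h₀⟩) (b := ⟨1, h₁⟩)
    ⟨0, ⟨le_rfl, hdist⟩, by rw [geodesic_zero, domRestrict_apply, hγ₀]⟩
    ⟨dist x y, ⟨hdist, le_rfl⟩, by rw [geodesic_dist, domRestrict_apply, hγ₁]⟩
  rintro _ ⟨t, ht, rfl⟩
  exact hIcc (show (⟨t, ht⟩ : Icc (0 : ℝ) 1) ∈ Icc _ _ from ⟨ht.1, ht.2⟩)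

theorem isRTree : IsRTree (BranchTree L) := by
  refine fun x y hxy => ⟨⟨_, isArc_geodesic hxy⟩, fun A A' hA hA' => ?_, fun A hA => ?_⟩
  · rw [eq_geodesic_image_of_isArc hA, eq_geodesic_image_of_isArc hA']
  · exact ⟨geodesic x y, geodesic_zero x y, geodesic_dist x y,
      fun _ hs _ ht => dist_geodesic hs ht, (eq_geodesic_image_of_isArc hA).symm⟩

end BranchTree

open BranchTree

/-- The lamplighter at `p.2` remembering the lamps lit strictly above it, where `f` is the
height function. -/
def lampBranch (f : X → ℝ) (p : Lamp X) : BranchTree (Finset X) :=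
  truncate (fun w => p.1.filter fun a => f a = w)
    (by
      obtain ⟨R, hR⟩ := (p.1.finite_toSet.image f).bddAbove
      refine ⟨R, fun r hr => Finset.filter_eq_empty_iff.2 fun a ha h => ?_⟩
      exact absurd (hR ⟨a, ha, h⟩) (not_le.2 hr))
    (f p.2)

@[simp]
theorem height_lampBranch (f : X → ℝ) (p : Lamp X) : (lampBranch f p).height = f p.2 := rfl

theorem mem_sd_iff {p q : Lamp X} {a : X} : a ∈ sd p q ↔ ¬(a ∈ p.1 ↔ a ∈ q.1) := by
  simp only [sd, mem_union, mem_sdiff, Finset.mem_coe]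
  tauto

theorem meet_lampBranch_le_iff {f : X → ℝ} {p q : Lamp X} {r : ℝ} :
    meet (lampBranch f p) (lampBranch f q) ≤ r ↔ ∀ a ∈ {p.2, q.2} ∪ sd p q, f a ≤ r := by
  rw [lampBranch, lampBranch, meet_truncate_le_iff]
  constructor
  · rintro ⟨hp, hq, h⟩ a ((rfl | rfl) | ha)
    · exact hp
    · exact hq
    · by_contra! hr
      refine mem_sd_iff.1 ha ?_
      simpa using Finset.ext_iff.1 (h (f a) hr) a
  · intro h
    refine ⟨h _ (by simp), h _ (by simp), fun w hw => Finset.ext fun a => ?_⟩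
    simp only [Finset.mem_filter]
    refine and_congr_left fun ha => ?_
    by_contra hne
    exact absurd (h a (Or.inr (mem_sd_iff.2 hne))) (by rw [ha]; exact not_le.2 hw)

theorem dist_lampBranch_le {f : X → ℝ} {p q : Lamp X} {D : ℝ}
    (h : ∀ a ∈ {p.2, q.2} ∪ sd p q, ∀ b ∈ {p.2, q.2} ∪ sd p q, 2 * (f a - f b) ≤ D) :
    dist (lampBranch f p) (lampBranch f q) ≤ D := by
  have hp : meet (lampBranch f p) (lampBranch f q) ≤ f p.2 + D / 2 :=
    meet_lampBranch_le_iff.2 fun a ha => by linarith [h a ha p.2 (by simp)]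
  have hq : meet (lampBranch f p) (lampBranch f q) ≤ f q.2 + D / 2 :=
    meet_lampBranch_le_iff.2 fun a ha => by linarith [h a ha q.2 (by simp)]
  rw [BranchTree.dist_eq, height_lampBranch, height_lampBranch]
  linarith

/-- The upward and the downward branches together see all height differences. -/
theorem two_mul_sub_le_dist_lampBranch {f : X → ℝ} {p q : Lamp X} {a b : X}
    (ha : a ∈ {p.2, q.2} ∪ sd p q) (hb : b ∈ {p.2, q.2} ∪ sd p q) :
    2 * (f a - f b) ≤ dist (lampBranch f p) (lampBranch f q) +
      dist (lampBranch (fun c => -f c) p) (lampBranch (fun c => -f c) q) := by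
  have h₁ := meet_lampBranch_le_iff.1 (le_refl (meet (lampBranch f p) (lampBranch f q))) a ha
  have h₂ := meet_lampBranch_le_iff.1
    (le_refl (meet (lampBranch (fun c => -f c) p) (lampBranch (fun c => -f c) q))) b hb
  simp only [BranchTree.dist_eq, height_lampBranch]
  linarith

/-- The leaf labelled by the lamp configuration in a star with legs of length `1 / 2`. -/
def configLeaf (p : Lamp X) : BranchTree (Finset X) :=
  truncate (fun w => if w = 1 / 2 then p.1 else default)
    ⟨1 / 2, fun _ hr => if_neg (ne_of_gt hr)⟩ 0

theorem dist_configLeaf (p q : Lamp X) : dist (configLeaf p) (configLeaf q) = rho p q := by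
  unfold rho
  split_ifs with h
  · rw [show configLeaf p = configLeaf q by simp only [configLeaf, h], dist_self]
  · have hm : meet (configLeaf p) (configLeaf q) = 1 / 2 := by
      refine le_antisymm (meet_truncate_le_iff.2 ⟨by norm_num, by norm_num, fun w hw => ?_⟩) ?_
      · rw [if_neg (ne_of_gt hw), if_neg (ne_of_gt hw)]
      · by_contra! hlt
        have := (meet_truncate_le_iff.1 (le_refl (meet (configLeaf p) (configLeaf q)))).2.2 _ hlt
        simp only [if_true] at this
        exact h this
    rw [BranchTree.dist_eq, hm]
    simp [configLeaf, truncate]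

theorem dist_le_TSCP [MetricSpace X] [Finite X] {p q : Lamp X} {a b : X}
    (ha : a ∈ {p.2, q.2} ∪ sd p q) (hb : b ∈ {p.2, q.2} ∪ sd p q) :
    dist a b ≤ TSCP dist p q := by
  have hbdd : Bornology.IsBounded (univ : Set X) := Set.finite_univ.isBounded
  have hfin : ediamD dist ({p.2, q.2} ∪ sd p q) ≠ ⊤ := by
    refine ne_top_of_le_ne_top (ENNReal.ofReal_ne_top (r := diam (univ : Set X))) ?_
    exact iSup₂_le fun x _ => iSup₂_le fun y _ =>
      ENNReal.ofReal_le_ofReal (dist_le_diam_of_mem hbdd (mem_univ x) (mem_univ y))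
  rw [TSCP, ← ENNReal.ofReal_le_iff_le_toReal hfin]
  exact le_iSup₂_of_le a ha (le_iSup₂_of_le (f := fun y _ => ENNReal.ofReal (dist a y)) b hb le_rfl)

theorem TSCP_le {d : X → X → ℝ} {p q : Lamp X} {r : ℝ} (hr : 0 ≤ r)
    (h : ∀ a ∈ {p.2, q.2} ∪ sd p q, ∀ b ∈ {p.2, q.2} ∪ sd p q, d a b ≤ r) :
    TSCP d p q ≤ r :=
  ENNReal.toReal_le_of_le_ofReal hr <| iSup₂_le fun a ha => iSup₂_le fun b hb =>
    ENNReal.ofReal_le_ofReal (h a ha b hb)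

theorem rho_nonneg (p q : Lamp X) : 0 ≤ rho p q := by
  unfold rho
  split_ifs <;> norm_num

theorem TSCP_nonneg (d : X → X → ℝ) (p q : Lamp X) : 0 ≤ TSCP d p q := ENNReal.toReal_nonneg

/-- The trees into which the lamplighter space is mapped: two for each coordinate of `f` and
one for the lamp configuration. -/
def lampCoord {ι : Type*} (f : ι → X → ℝ) (p : Lamp X) : Fin 3 × ι → BranchTree (Finset X)
  | (0, i) => lampBranch (f i) p
  | (1, i) => lampBranch (fun c => -f i c) p
  | (2, _) => configLeaf p

theorem dist_lampCoord_le [MetricSpace X] [Finite X] {ι : Type*} {f : ι → X → ℝ}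
    (hf : ∀ i a b, 2 * |f i a - f i b| ≤ dist a b) (p q : Lamp X) (j : Fin 3 × ι) :
    dist (lampCoord f p j) (lampCoord f q j) ≤ TSCP dist p q + rho p q := by
  have hρ := rho_nonneg p q
  have hT := TSCP_nonneg dist p q
  obtain ⟨k, i⟩ := j
  fin_cases k
  · refine dist_lampBranch_le fun a ha b hb => ?_
    linarith [hf i a b, le_abs_self (f i a - f i b), dist_le_TSCP ha hb]
  · refine dist_lampBranch_le fun a ha b hb => ?_
    linarith [hf i a b, neg_abs_le (f i a - f i b), dist_le_TSCP ha hb]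
  · refine (dist_configLeaf p q).le.trans ?_
    linarith

theorem exists_le_dist_lampCoord {ι : Type*} {f : ι → X → ℝ} {p q : Lamp X} {a b : X}
    (ha : a ∈ {p.2, q.2} ∪ sd p q) (hb : b ∈ {p.2, q.2} ∪ sd p q) (i : ι) :
    ∃ j, |f i a - f i b| ≤ dist (lampCoord f p j) (lampCoord f q j) := by
  have h₁ := two_mul_sub_le_dist_lampBranch (f := f i) ha hb
  have h₂ := two_mul_sub_le_dist_lampBranch (f := f i) hb ha
  by_contra! h
  have h₃ : dist (lampBranch (f i) p) (lampBranch (f i) q) < _ := h (0, i)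
  have h₄ : dist (lampBranch (fun c => -f i c) p) (lampBranch (fun c => -f i c) q) < _ := h (1, i)
  rcases abs_cases (f i a - f i b) with ⟨h₅, -⟩ | ⟨h₅, -⟩ <;> linarith

theorem EuclideanSpace.exists_le_abs_sub {m : ℕ} (hm : 1 ≤ m) {x y : EuclideanSpace ℝ (Fin m)}
    {s : ℝ} (h : m * s ≤ dist x y) : ∃ i, s ≤ |x i - y i| := by
  by_contra! hlt
  have hm' : (1 : ℝ) ≤ m := by exact_mod_cast hm
  have hs : 0 < s := (abs_nonneg _).trans_lt (hlt ⟨0, hm⟩)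
  have hsum : ∑ i, dist (x i) (y i) ^ 2 < ∑ _i : Fin m, s ^ 2 := by
    refine Finset.sum_lt_sum_of_nonempty ⟨⟨0, hm⟩, Finset.mem_univ _⟩ fun i _ => ?_
    rw [Real.dist_eq]
    exact pow_lt_pow_left₀ (hlt i) (abs_nonneg _) two_ne_zero
  have hsq : dist x y ^ 2 = ∑ i, dist (x i) (y i) ^ 2 := EuclideanSpace.dist_sq_eq x y
  have h₁ : (m * s) ^ 2 ≤ dist x y ^ 2 := pow_le_pow_left₀ (by positivity) h 2
  rw [Finset.sum_const, Finset.card_univ, Fintype.card_fin, nsmul_eq_mul] at hsum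
  nlinarith [mul_nonneg (sub_nonneg.2 hm') (by positivity : 0 ≤ m * s ^ 2)]

theorem EuclideanSpace.abs_sub_le_dist {m : ℕ} (x y : EuclideanSpace ℝ (Fin m)) (i : Fin m) :
    |x i - y i| ≤ dist x y := by
  rw [dist_eq_norm]
  exact PiLp.norm_apply_le (x - y) i

/-- If a finite metric space `X` admits a weak `C`-biLipschitz embedding
into Euclidean `ℝ^m`, then `(La(X), TSCP + ρ)` admits a weak `C'`-biLipschitz embedding
into an ℓ∞-product of `3m` ℝ-trees, where `C'` depends only on `C` and `m`. -/
theorem statement7 (m : ℕ) (hm : 1 ≤ m) (C : ℝ) :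
    ∃ C' : ℝ, 0 < C' ∧
      ∀ (X : Type u) [MetricSpace X] [Fintype X],
        WeakBiLip (dist : X → X → ℝ)
          (dist : EuclideanSpace ℝ (Fin m) → EuclideanSpace ℝ (Fin m) → ℝ) C →
        ∃ (T : Fin (3 * m) → Type u) (I : ∀ i, MetricSpace (T i)),
          (∀ i, @IsRTree (T i) (I i)) ∧
          WeakBiLip (fun p q : Lamp X => TSCP (dist : X → X → ℝ) p q + rho p q)
            (piSupDist I) C' := by
  have hm₀ : (0 : ℝ) < m := by exact_mod_cast hm
  refine ⟨2 + 4 * m * |C|, by positivity, fun X _ _ ⟨φ, hφ⟩ => ?_⟩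
  refine ⟨fun _ => BranchTree (Finset X), fun _ => inferInstance, fun _ => BranchTree.isRTree, ?_⟩
  choose! σ hσ hlip hlow using hφ
  let s : ℝ → ℝ := fun t => 2 * m * t
  let f : ℝ → Fin m → X → ℝ := fun t i a => φ (s t) a i / (2 * σ (s t))
  refine ⟨fun t p j => lampCoord (f t) p (finProdFinEquiv.symm j), fun t ht => ⟨1, one_pos, ?_, ?_⟩⟩
  all_goals
    intro p q
    have hst : 0 < s t := by positivity
    have hσt := hσ _ hst
    have hf : ∀ i a b, 2 * |f t i a - f t i b| = |φ (s t) a i - φ (s t) b i| / σ (s t) := by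
      intro i a b
      simp only [f]
      rw [← sub_div, abs_div, abs_of_pos (by positivity : 0 < 2 * σ (s t))]
      field_simp
  · rw [one_mul, piSupDist, dist_pi_le_iff (add_nonneg (TSCP_nonneg _ p q) (rho_nonneg p q))]
    refine fun j => dist_lampCoord_le (fun i a b => ?_) p q _
    rw [hf, div_le_iff₀ hσt, mul_comm]
    exact (EuclideanSpace.abs_sub_le_dist _ _ i).trans (hlip _ hst a b)
  · intro h
    rw [mul_one]
    suffices ∃ j, t ≤ dist (lampCoord (f t) p j) (lampCoord (f t) q j) by
      obtain ⟨j, hj⟩ := this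
      refine hj.trans ?_
      rw [piSupDist]
      refine le_trans ?_ (dist_le_pi_dist _ _ (finProdFinEquiv j))
      simp only [Equiv.symm_apply_apply, le_refl]
    have hCt : 0 ≤ 4 * m * |C| * t := by positivity
    by_cases hρ : t ≤ rho p q
    · exact ⟨(2, ⟨0, hm⟩), hρ.trans (dist_configLeaf p q).ge⟩
    · have hT : |C| * s t < TSCP dist p q := by
        have hst' : |C| * s t = 2 * m * |C| * t := by simp only [s]; ring
        have hρ₁ : rho p q = 0 ∨ rho p q = 1 := by unfold rho; split_ifs <;> simp
        nlinarith
      obtain ⟨a, ha, b, hb, hab⟩ : ∃ a ∈ {p.2, q.2} ∪ sd p q, ∃ b ∈ {p.2, q.2} ∪ sd p q,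
          |C| * s t < dist a b := by
        by_contra! hle
        exact absurd (TSCP_le (by positivity) hle) (not_le.2 hT)
      have hCs : C * s t ≤ dist a b :=
        (mul_le_mul_of_nonneg_right (le_abs_self C) hst.le).trans hab.le
      have hd := hlow _ hst a b hCs
      obtain ⟨i, hi⟩ := EuclideanSpace.exists_le_abs_sub hm (s := 2 * t * σ (s t))
        (le_trans (by simp only [s]; linarith) hd)
      obtain ⟨j, hj⟩ := exists_le_dist_lampCoord (f := f t) ha hb i
      refine ⟨j, le_trans ?_ hj⟩
      have := (le_div_iff₀ hσt).2 hi
      rw [← hf] at this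
      linarith

end Lamplighter
end
end

section
/- There is an absolute constant c < ∞ such that for all n,k ∈ ℕ, the lamplighter space (La(St_{n,k}), d_La) over the star graph St_{n,k} admits a biLipschitz embedding with distortion at most c·n into an ℓ1-product of 3(2^n − 1) ℝ-trees. -/
open Metric Set
open scoped Classical ENNReal NNReal

noncomputable section

namespace Lamplighter

variable {X Y Z : Type*}

/-! ### Geodesic spaces satisfying the four-point condition are ℝ-trees -/

section RTree

variable {T : Type*} [MetricSpace T]

/-- Gromov's four-point condition with constant `0`. -/
def FourPoint (T : Type*) [PseudoMetricSpace T] : Prop :=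
  ∀ x y z w : T, dist x y + dist z w ≤ max (dist x z + dist y w) (dist x w + dist y z)

/-- A point of a geodesic lies on every path with the same endpoints. -/
theorem FourPoint.mem_image_of_dist_add_eq (h4 : FourPoint T) {x y z : T}
    (hz : dist x z + dist z y = dist x y) {γ : ℝ → T} (hγ : ContinuousOn γ (Icc 0 1))
    (h0 : γ 0 = x) (h1 : γ 1 = y) : z ∈ γ '' Icc 0 1 := by
  by_contra hmem
  have hpos : ∀ p ∈ γ '' Icc 0 1, 0 < dist p z := fun p hp =>
    dist_pos.2 fun h => hmem (h ▸ hp)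
  have hconn : IsPreconnected (γ '' Icc 0 1) := isPreconnected_Icc.image γ hγ
  have hx : x ∈ γ '' Icc 0 1 := ⟨0, by simp, h0⟩
  have hy : y ∈ γ '' Icc 0 1 := ⟨1, by simp, h1⟩
  let U : Set T := {p | dist p x < dist p z + dist x z}
  let V : Set T := {p | ∃ q, dist q z + dist x z ≤ dist q x ∧ dist p q < dist q z}
  have hU : IsOpen U := isOpen_lt (by fun_prop) (by fun_prop)
  have hV : IsOpen V := by
    have : V = ⋃ q ∈ {q | dist q z + dist x z ≤ dist q x}, ball q (dist q z) := by
      ext p; simp [V]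
    rw [this]
    exact isOpen_biUnion fun _ _ => isOpen_ball
  have hcover : γ '' Icc 0 1 ⊆ U ∪ V := fun p hp => by
    by_cases hpU : dist p x < dist p z + dist x z
    · exact Or.inl hpU
    · exact Or.inr ⟨p, not_lt.1 hpU, by simpa using hpos p hp⟩
  obtain ⟨p, hp, hpU, q, hq, hpq⟩ := hconn U V hU hV hcover
    ⟨x, hx, by simpa [U] using hpos x hx⟩
    ⟨y, hy, y, by rw [dist_comm y x, dist_comm y z]; linarith, by simpa using hpos y hy⟩
  have hpU : dist p x < dist p z + dist x z := hpU
  have h := h4 q x z p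
  rw [dist_comm z p, dist_comm q p, dist_comm x p] at h
  have hpz : 0 ≤ dist p z := dist_nonneg
  rcases le_max_iff.1 h with h | h <;> linarith

theorem isRTree_of_geodesic_of_fourPoint (hgeo : ∀ x y : T, ∃ A, IsGeodesicSeg x y A)
    (h4 : FourPoint T) : IsRTree T := by
  have key : ∀ {x y : T} {A G : Set T}, IsArc x y A → IsGeodesicSeg x y G → A = G := by
    rintro x y A G ⟨γ, hγ, hinj, h0, h1, rfl⟩ ⟨g, g0, g1, hg, rfl⟩
    have hd : (0 : ℝ) ≤ dist x y := dist_nonneg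
    have hsub : g '' Icc 0 (dist x y) ⊆ γ '' Icc 0 1 := by
      rintro _ ⟨t, ht, rfl⟩
      refine h4.mem_image_of_dist_add_eq ?_ hγ h0 h1
      have e0 := hg 0 ⟨le_rfl, hd⟩ t ht
      have e1 := hg t ht _ ⟨hd, le_rfl⟩
      rw [g0, zero_sub, abs_neg, abs_of_nonneg ht.1] at e0
      rw [g1, abs_sub_comm, abs_of_nonneg (sub_nonneg.2 ht.2)] at e1
      linarith
    refine Subset.antisymm ?_ hsub
    have gcont : ContinuousOn g (Icc 0 (dist x y)) := by
      refine (LipschitzOnWith.of_dist_le_mul (K := 1) fun s hs t ht => ?_).continuousOn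
      simp [hg s hs t ht, Real.dist_eq]
    have hconn : IsConnected (g '' Icc 0 (dist x y)) :=
      (isConnected_Icc hd).image g gcont
    let r : Icc (0 : ℝ) 1 → T := (Icc (0 : ℝ) 1).domRestrict γ
    have hr : Topology.IsClosedEmbedding r :=
      (continuousOn_iff_continuous_domRestrict.1 hγ).isClosedEmbedding hinj.injective
    have hpre : IsPreconnected (r ⁻¹' (g '' Icc 0 (dist x y))) := by
      refine hconn.isPreconnected.preimage_of_isClosedMap hr.injective hr.isClosedMap ?_
      rw [Set.range_domRestrict]
      exact hsub
    have hval : IsPreconnected (Subtype.val '' (r ⁻¹' (g '' Icc 0 (dist x y)))) :=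
      hpre.image _ continuous_subtype_val.continuousOn
    have hIcc := hval.ordConnected.out
      (x := (0 : ℝ)) ⟨⟨0, by simp⟩, ⟨0, ⟨le_rfl, hd⟩, g0.trans h0.symm⟩, rfl⟩
      (y := (1 : ℝ)) ⟨⟨1, by simp⟩, ⟨_, ⟨hd, le_rfl⟩, g1.trans h1.symm⟩, rfl⟩
    rintro _ ⟨t, ht, rfl⟩
    obtain ⟨t', ht', rfl⟩ := hIcc ht
    exact ht'
  intro x y hxy
  obtain ⟨G, hG⟩ := hgeo x y
  refine ⟨⟨G, ?_⟩, fun A A' hA hA' => (key hA hG).trans (key hA' hG).symm,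
    fun A hA => key hA hG ▸ hG⟩
  obtain ⟨g, g0, g1, hg, rfl⟩ := hG
  have hd : 0 < dist x y := dist_pos.2 hxy
  have hmaps : MapsTo (fun t => dist x y * t) (Icc 0 1) (Icc 0 (dist x y)) := fun t ht =>
    ⟨mul_nonneg hd.le ht.1, mul_le_of_le_one_right hd.le ht.2⟩
  have hdist : ∀ s ∈ Icc (0 : ℝ) 1, ∀ t ∈ Icc (0 : ℝ) 1,
      dist (g (dist x y * s)) (g (dist x y * t)) = dist x y * |s - t| := fun s hs t ht => by
    rw [hg _ (hmaps hs) _ (hmaps ht), ← mul_sub, abs_mul, abs_of_pos hd]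
  refine ⟨fun t => g (dist x y * t), ?_, ?_, by simpa using g0, by simpa using g1, ?_⟩
  · refine (LipschitzOnWith.of_dist_le_mul (K := (dist x y).toNNReal)
      fun s hs t ht => ?_).continuousOn
    rw [hdist s hs t ht, Real.coe_toNNReal _ hd.le, Real.dist_eq]
  · intro s hs t ht hst
    have h := hdist s hs t ht
    rw [show g (dist x y * s) = g (dist x y * t) from hst, dist_self] at h
    rcases mul_eq_zero.1 h.symm with h | h
    · exact absurd h hd.ne'
    · exact sub_eq_zero.1 (abs_eq_zero.1 h)
  · refine Subset.antisymm ?_ ?_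
    · rintro _ ⟨t, ht, rfl⟩
      exact ⟨_, hmaps ht, rfl⟩
    · rintro _ ⟨t, ht, rfl⟩
      exact ⟨t / dist x y, ⟨div_nonneg ht.1 hd.le, div_le_one_of_le₀ ht.2 hd.le⟩,
        by simp only [mul_div_cancel₀ t hd.ne']⟩

end RTree

/-! ### The ℝ-tree over an ultrametric -/

/-- An ultra-pseudometric on `Ω`. -/
structure UltraDist (Ω : Type*) where
  toFun : Ω → Ω → ℝ≥0
  self : ∀ a, toFun a a = 0
  symm : ∀ a b, toFun a b = toFun b a
  ultra : ∀ a b c, toFun a c ≤ max (toFun a b) (toFun b c)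

/-- The cone over an ultra-pseudometric space: above each point of `Ω` stands a vertical ray,
and the rays over `a` and `b` merge at height `u a b`. -/
structure UltraCone {Ω : Type*} (u : UltraDist Ω) where
  base : Ω
  height : ℝ≥0

namespace UltraCone

variable {Ω : Type*} {u : UltraDist Ω}

/-- The height at which the upward rays from `p` and `q` meet. -/
def meet (p q : UltraCone u) : ℝ :=
  max (max (p.height : ℝ) q.height) (u.toFun p.base q.base)

theorem meet_comm (p q : UltraCone u) : meet p q = meet q p := by
  rw [meet, meet, u.symm, max_comm (p.height : ℝ)]

theorem height_le_meet_left (p q : UltraCone u) : (p.height : ℝ) ≤ meet p q := by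
  simp [meet]

theorem height_le_meet_right (p q : UltraCone u) : (q.height : ℝ) ≤ meet p q := by
  simp [meet]

theorem meet_ultra (p q r : UltraCone u) : meet p r ≤ max (meet p q) (meet q r) := by
  have h : (u.toFun p.base r.base : ℝ) ≤
      max (u.toFun p.base q.base : ℝ) (u.toFun q.base r.base) := mod_cast u.ultra _ _ _
  refine max_le (max_le ?_ ?_) (h.trans ?_)
  · exact (height_le_meet_left p q).trans (le_max_left _ _)
  · exact (height_le_meet_right q r).trans (le_max_right _ _)
  · exact max_le_max (le_max_right _ _) (le_max_right _ _)

instance : PseudoMetricSpace (UltraCone u) where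
  dist p q := 2 * meet p q - p.height - q.height
  dist_self p := by simp [meet, u.self]; ring
  dist_comm p q := by rw [meet_comm]; ring
  dist_triangle p q r := by
    have := height_le_meet_right p q
    have := height_le_meet_left q r
    rcases le_max_iff.1 (meet_ultra p q r) with h | h <;> linarith

theorem dist_def (p q : UltraCone u) : dist p q = 2 * meet p q - p.height - q.height := rfl

theorem fourPoint : FourPoint (UltraCone u) := by
  intro x y z w
  simp only [dist_def]
  have h1 := meet_ultra x z y
  have h2 := meet_ultra x w y
  have h3 := meet_ultra z x w
  have h4 := meet_ultra z y w
  rw [meet_comm z y] at h1 h4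
  rw [meet_comm z x] at h3
  rw [meet_comm w y] at h2
  rw [le_max_iff] at h1 h2 h3 h4 ⊢
  by_contra hcon
  rw [not_or, not_le, not_le] at hcon
  rcases h1 with h1 | h1 <;> rcases h2 with h2 | h2 <;> rcases h3 with h3 | h3 <;>
    rcases h4 with h4 | h4 <;> linarith [hcon.1, hcon.2]

theorem exists_geodesic (p q : UltraCone u) : ∃ γ : ℝ → UltraCone u,
    γ 0 = p ∧ dist (γ (dist p q)) q = 0 ∧
      ∀ s ∈ Icc (0 : ℝ) (dist p q), ∀ t ∈ Icc (0 : ℝ) (dist p q),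
        dist (γ s) (γ t) = |s - t| := by
  have hp := height_le_meet_left p q
  have hq := height_le_meet_right p q
  have hp0 : (0 : ℝ) ≤ p.height := p.height.2
  have hq0 : (0 : ℝ) ≤ q.height := q.height.2
  set M := meet p q with hM
  have hd : dist p q = 2 * M - p.height - q.height := rfl
  let up (r : ℝ) : UltraCone u := ⟨p.base, (p.height + r).toNNReal⟩
  let down (r : ℝ) : UltraCone u := ⟨q.base, (q.height + (dist p q - r)).toNNReal⟩
  let γ (r : ℝ) : UltraCone u := if r ≤ M - p.height then up r else down r
  have hγup : ∀ {r}, r ≤ M - p.height → γ r = up r := fun h => if_pos h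
  have hγdown : ∀ {r}, ¬ r ≤ M - p.height → γ r = down r := fun h => if_neg h
  have hup : ∀ {r}, 0 ≤ r → ((up r).height : ℝ) = p.height + r := fun h =>
    Real.coe_toNNReal _ (by linarith)
  have hdown : ∀ {r}, r ≤ dist p q → ((down r).height : ℝ) = q.height + (dist p q - r) :=
    fun h => Real.coe_toNNReal _ (by linarith)
  have hbase : ∀ {a b : UltraCone u}, a.base = b.base →
      dist a b = |(a.height : ℝ) - b.height| := by
    intro a b h
    have ha0 : (0 : ℝ) ≤ a.height := a.height.2
    rw [dist_def, meet, h, u.self, NNReal.coe_zero, max_eq_left (le_max_of_le_left ha0)]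
    rcases le_total (a.height : ℝ) b.height with h | h
    · rw [max_eq_right h, abs_of_nonpos (by linarith)]; ring
    · rw [max_eq_left h, abs_of_nonneg (by linarith)]; ring
  have hmix : ∀ s ∈ Icc (0 : ℝ) (dist p q), ∀ t ∈ Icc (0 : ℝ) (dist p q),
      s ≤ M - p.height → ¬ t ≤ M - p.height → dist (up s) (down t) = t - s := by
    intro s hs t ht h1 h2
    have ea := hup hs.1
    have eb := hdown ht.2
    have hmeet : meet (up s) (down t) = M := by
      apply le_antisymm
      · refine max_le (max_le ?_ ?_) (le_max_right _ _)
        · rw [ea]; linarith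
        · rw [eb]; linarith
      · refine max_le (max_le ?_ ?_) (le_max_right _ _)
        · refine le_trans ?_ (height_le_meet_left _ _)
          rw [ea]; linarith [hs.1]
        · refine le_trans ?_ (height_le_meet_right _ _)
          rw [eb]; linarith [ht.2]
    rw [dist_def, hmeet, ea, eb, hd]
    ring
  refine ⟨γ, ?_, ?_, ?_⟩
  · rw [hγup (by linarith)]
    simp [up]
  · by_cases h : dist p q ≤ M - p.height
    · have hMq : M = q.height := by linarith
      have hd0 : (0 : ℝ) ≤ dist p q := dist_nonneg
      have eb := hup hd0
      have : meet (up (dist p q)) q = M := by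
        refine le_antisymm (max_le (max_le ?_ hq) (le_max_right _ _)) ?_
        · rw [eb]; linarith
        · exact hMq.le.trans (height_le_meet_right _ _)
      rw [hγup h, dist_def, this, eb]; linarith
    · rw [hγdown h, hbase (a := down (dist p q)) (b := q) rfl, hdown le_rfl]
      simp
  · intro s hs t ht
    by_cases h1 : s ≤ M - p.height <;> by_cases h2 : t ≤ M - p.height
    · rw [hγup h1, hγup h2, hbase (a := up s) (b := up t) rfl, hup hs.1, hup ht.1, add_sub_add_left_eq_sub]
    · rw [hγup h1, hγdown h2, hmix s hs t ht h1 h2, abs_sub_comm, abs_of_nonneg (by linarith)]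
    · rw [hγdown h1, hγup h2, dist_comm, hmix t ht s hs h2 h1, abs_of_nonneg (by linarith)]
    · rw [hγdown h1, hγdown h2, hbase (a := down s) (b := down t) rfl, hdown hs.2, hdown ht.2, abs_sub_comm]
      congr 1
      ring

theorem isRTree_separationQuotient : IsRTree (SeparationQuotient (UltraCone u)) := by
  refine isRTree_of_geodesic_of_fourPoint ?_ ?_
  · intro x y
    obtain ⟨p, rfl⟩ := SeparationQuotient.surjective_mk x
    obtain ⟨q, rfl⟩ := SeparationQuotient.surjective_mk y
    obtain ⟨γ, h0, h1, hγ⟩ := exists_geodesic p q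
    refine ⟨_, fun r => SeparationQuotient.mk (γ r), congrArg SeparationQuotient.mk h0, ?_, ?_, rfl⟩
    · rw [SeparationQuotient.dist_mk, SeparationQuotient.mk_eq_mk]
      exact Metric.inseparable_iff.2 h1
    · simpa only [SeparationQuotient.dist_mk] using hγ
  · intro x y z w
    obtain ⟨x, rfl⟩ := SeparationQuotient.surjective_mk x
    obtain ⟨y, rfl⟩ := SeparationQuotient.surjective_mk y
    obtain ⟨z, rfl⟩ := SeparationQuotient.surjective_mk z
    obtain ⟨w, rfl⟩ := SeparationQuotient.surjective_mk w
    simpa only [SeparationQuotient.dist_mk] using fourPoint x y z w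

end UltraCone

/-! ### The tree pseudometric on a lamplighter space induced by a height function -/

/-- Two configurations are at distance `1 +` the largest height at which they differ. -/
def lampUltra (φ : X → ℝ≥0) : UltraDist (Finset X) where
  toFun A B := (symmDiff A B).sup fun a => φ a + 1
  self A := by simp
  symm A B := by rw [symmDiff_comm]
  ultra A B C := by
    rw [← Finset.sup_union]
    exact Finset.sup_mono (symmDiff_triangle A B C)

/-- The point of the tree of `φ` corresponding to a point of the lamplighter space. -/
def lampPoint (φ : X → ℝ≥0) (p : Lamp X) : SeparationQuotient (UltraCone (lampUltra φ)) :=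
  SeparationQuotient.mk ⟨p.1, φ p.2⟩

section TSP

variable {d : X → X → ℝ}

theorem mem_sd {p q : Lamp X} {a : X} : a ∈ sd p q ↔ a ∈ symmDiff p.1 q.1 := by
  simp [sd, Finset.mem_symmDiff]

theorem pathLength_nonneg (h0 : ∀ x y, 0 ≤ d x y) (l : List X) : 0 ≤ pathLength d l := by
  induction l with
  | nil => simp [pathLength]
  | cons x l ih =>
    cases l with
    | nil => simp [pathLength]
    | cons y l => exact add_nonneg (h0 x y) ih

theorem dist_le_pathLength (hs : ∀ x, d x x = 0)
    (ht : ∀ x y z, d x z ≤ d x y + d y z) {x y : X} {l : List X}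
    (hx : l.head? = some x) (hy : l.getLast? = some y) : d x y ≤ pathLength d l := by
  induction l generalizing x with
  | nil => simp at hx
  | cons z l ih =>
    obtain rfl : z = x := by simpa using hx
    cases l with
    | nil =>
      obtain rfl : z = y := by simpa using hy
      simp [pathLength, hs]
    | cons w l =>
      have := ih (x := w) rfl (by simpa [List.getLast?_cons_cons] using hy)
      have := ht z w y
      simp only [pathLength]
      linarith

theorem dist_add_dist_le_pathLength (hs : ∀ x, d x x = 0)
    (ht : ∀ x y z, d x z ≤ d x y + d y z) {x y a : X} {l : List X}
    (hx : l.head? = some x) (hy : l.getLast? = some y) (ha : a ∈ l) :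
    d x a + d a y ≤ pathLength d l := by
  induction l generalizing x with
  | nil => simp at hx
  | cons z l ih =>
    obtain rfl : z = x := by simpa using hx
    rcases List.mem_cons.1 ha with rfl | ha
    · simpa [hs] using dist_le_pathLength hs ht hx hy
    · cases l with
      | nil => simp at ha
      | cons w l =>
        have := ih (x := w) rfl (by simpa [List.getLast?_cons_cons] using hy) ha
        have := ht z w a
        simp only [pathLength]
        linarith

theorem TSP_set_nonempty (p q : Lamp X) :
    { s : ℝ | ∃ l : List X, l.head? = some p.2 ∧ l.getLast? = some q.2 ∧
      (∀ a ∈ sd p q, a ∈ l) ∧ s = pathLength d l }.Nonempty :=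
  ⟨_, p.2 :: ((symmDiff p.1 q.1).toList ++ [q.2]), rfl, List.getLast?_concat (l := _ :: _),
    fun a ha => by simp [mem_sd.1 ha], rfl⟩

theorem dist_le_TSP (hs : ∀ x, d x x = 0)
    (ht : ∀ x y z, d x z ≤ d x y + d y z) (p q : Lamp X) : d p.2 q.2 ≤ TSP d p q := by
  refine le_csInf (TSP_set_nonempty p q) ?_
  rintro _ ⟨l, hx, hy, -, rfl⟩
  exact dist_le_pathLength hs ht hx hy

theorem dist_add_dist_le_TSP (hs : ∀ x, d x x = 0)
    (ht : ∀ x y z, d x z ≤ d x y + d y z) {p q : Lamp X} {a : X}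
    (ha : a ∈ symmDiff p.1 q.1) : d p.2 a + d a q.2 ≤ TSP d p q := by
  refine le_csInf (TSP_set_nonempty p q) ?_
  rintro _ ⟨l, hx, hy, hl, rfl⟩
  exact dist_add_dist_le_pathLength hs ht hx hy (hl a (mem_sd.2 ha))

theorem dist_lampPoint (φ : X → ℝ≥0) (p q : Lamp X) :
    dist (lampPoint φ p) (lampPoint φ q) =
      2 * max (max (φ p.2 : ℝ) (φ q.2)) ((symmDiff p.1 q.1).sup fun a => φ a + 1 : ℝ≥0)
        - φ p.2 - φ q.2 := rfl

theorem le_dist_lampPoint (φ : X → ℝ≥0) {p q : Lamp X} {a : X}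
    (ha : a ∈ symmDiff p.1 q.1) :
    2 * (φ a + 1) - φ p.2 - φ q.2 ≤ dist (lampPoint φ p) (lampPoint φ q) := by
  rw [dist_lampPoint]
  have h : φ a + 1 ≤ (symmDiff p.1 q.1).sup fun a => φ a + 1 :=
    Finset.le_sup (f := fun a => φ a + 1) ha
  have h' : (φ a : ℝ) + 1 ≤ ((symmDiff p.1 q.1).sup fun a => φ a + 1 : ℝ≥0) := mod_cast h
  linarith [h'.trans (le_max_right (max (φ p.2 : ℝ) (φ q.2)) _)]

theorem le_dist_lampPoint_of_mem (φ : X → ℝ≥0) {p q : Lamp X} {a : X}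
    (ha : a ∈ insert p.2 (insert q.2 (symmDiff p.1 q.1))) :
    2 * φ a - φ p.2 - φ q.2 ≤ dist (lampPoint φ p) (lampPoint φ q) := by
  rcases Finset.mem_insert.1 ha with rfl | ha
  · rw [dist_lampPoint]
    linarith [(le_max_left (φ p.2 : ℝ) (φ q.2)).trans (le_max_left _
      (((symmDiff p.1 q.1).sup fun a => φ a + 1 : ℝ≥0) : ℝ))]
  rcases Finset.mem_insert.1 ha with rfl | ha
  · rw [dist_lampPoint]
    linarith [(le_max_right (φ p.2 : ℝ) (φ q.2)).trans (le_max_left _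
      (((symmDiff p.1 q.1).sup fun a => φ a + 1 : ℝ≥0) : ℝ))]
  · linarith [le_dist_lampPoint φ ha]

theorem dist_lampPoint_le (h0 : ∀ x y, 0 ≤ d x y) (hs : ∀ x, d x x = 0)
    (hc : ∀ x y, d x y = d y x) (ht : ∀ x y z, d x z ≤ d x y + d y z) (φ : X → ℝ≥0)
    (hφ : ∀ x y, (φ x : ℝ) - φ y ≤ d x y) (p q : Lamp X) :
    dist (lampPoint φ p) (lampPoint φ q) ≤ 2 * dLa d p q := by
  have hxy := dist_le_TSP hs ht p q
  have hρ : 0 ≤ rho p q := by unfold rho; split_ifs <;> norm_num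
  have h1 := hφ p.2 q.2
  have h2 := hφ q.2 p.2
  rw [hc] at h2
  have h3 := h0 p.2 q.2
  suffices h : max (max (φ p.2 : ℝ) (φ q.2))
      ((symmDiff p.1 q.1).sup fun a => φ a + 1 : ℝ≥0) ≤
      (φ p.2 + φ q.2) / 2 + dLa d p q by
    rw [dist_lampPoint]; linarith
  unfold dLa
  have hb : (0 : ℝ) ≤ (φ p.2 + φ q.2) / 2 + (TSP d p q + rho p q) := by
    have := (φ p.2).2
    have := (φ q.2).2
    positivity [h3.trans hxy]
  refine max_le (max_le (by linarith) (by linarith)) ?_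
  rw [← Real.coe_toNNReal _ hb, NNReal.coe_le_coe]
  refine Finset.sup_le fun a ha => ?_
  rw [← NNReal.coe_le_coe, Real.coe_toNNReal _ hb]
  have hne : p.1 ≠ q.1 := by
    rintro h
    simp [h] at ha
  have := dist_add_dist_le_TSP hs ht ha
  have := hφ a p.2
  rw [hc] at this
  have := hφ a q.2
  have := h0 p.2 a
  have := h0 a q.2
  simp only [rho, if_neg hne, NNReal.coe_add, NNReal.coe_one]
  linarith

end TSP

/-! ### Tours -/

section Tour

variable {d : X → X → ℝ}

/-- There is a path of length at most `ℓ` from `x` to `y` visiting all points of `S`. -/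
def Tour (d : X → X → ℝ) (x y : X) (S : Set X) (ℓ : ℝ) : Prop :=
  ∃ l : List X, l.head? = some x ∧ l.getLast? = some y ∧ (∀ a ∈ S, a ∈ l) ∧ pathLength d l ≤ ℓ

theorem Tour.mono {x y : X} {S S' : Set X} {ℓ ℓ' : ℝ} (h : Tour d x y S ℓ) (hS : S' ⊆ S)
    (hℓ : ℓ ≤ ℓ') : Tour d x y S' ℓ' := by
  obtain ⟨l, hx, hy, hl, hle⟩ := h
  exact ⟨l, hx, hy, fun a ha => hl a (hS ha), hle.trans hℓ⟩

theorem Tour.pair (x y : X) : Tour d x y {x, y} (d x y) :=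
  ⟨[x, y], rfl, rfl, by simp, by simp [pathLength]⟩

theorem Tour.point (x : X) : Tour d x x {x} 0 :=
  ⟨[x], rfl, rfl, by simp, by simp [pathLength]⟩

theorem pathLength_append (hs : ∀ x, d x x = 0) {y : X} {l l' : List X}
    (hl : l.getLast? = some y) (hl' : l'.head? = some y) :
    pathLength d (l ++ l') = pathLength d l + pathLength d l' := by
  induction l with
  | nil => simp at hl
  | cons a l ih =>
    cases l with
    | nil =>
      obtain rfl : a = y := by simpa using hl
      cases l' with
      | nil => simp at hl'
      | cons b l' =>
        obtain rfl : b = a := by simpa using hl'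
        simp [pathLength, hs]
    | cons b l =>
      have := ih (by simpa [List.getLast?_cons_cons] using hl)
      simp only [List.cons_append, pathLength] at this ⊢
      rw [this, add_assoc]

theorem Tour.trans (hs : ∀ x, d x x = 0) {x y z : X} {S S' : Set X} {ℓ ℓ' : ℝ}
    (h : Tour d x y S ℓ) (h' : Tour d y z S' ℓ') : Tour d x z (S ∪ S') (ℓ + ℓ') := by
  obtain ⟨l, hx, hy, hl, hle⟩ := h
  obtain ⟨l', hy', hz, hl', hle'⟩ := h'
  refine ⟨l ++ l', by simp [List.head?_append, hx], by simp [List.getLast?_append, hz], ?_, ?_⟩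
  · rintro a (ha | ha)
    · exact List.mem_append_left _ (hl a ha)
    · exact List.mem_append_right _ (hl' a ha)
  · rw [pathLength_append hs hy hy']
    exact add_le_add hle hle'

theorem TSP_le_of_tour (h0 : ∀ x y, 0 ≤ d x y) {p q : Lamp X} {ℓ : ℝ}
    (h : Tour d p.2 q.2 (symmDiff p.1 q.1 : Finset X) ℓ) : TSP d p q ≤ ℓ := by
  obtain ⟨l, hx, hy, hl, hle⟩ := h
  refine le_trans (csInf_le ⟨0, ?_⟩ ⟨l, hx, hy, fun a ha => hl a (mem_sd.1 ha), rfl⟩) hle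
  rintro _ ⟨l, -, -, -, rfl⟩
  exact pathLength_nonneg h0 l

end Tour

/-! ### The star graph -/

namespace St

variable {n k : ℕ}

theorem stDist_nonneg (x y : St n k) : 0 ≤ stDist x y :=
  Finset.sum_nonneg fun _ _ => abs_nonneg _

theorem stDist_self (x : St n k) : stDist x x = 0 := by simp [stDist]

theorem stDist_comm (x y : St n k) : stDist x y = stDist y x := by
  simp only [stDist, abs_sub_comm]

theorem stDist_triangle (x y z : St n k) : stDist x z ≤ stDist x y + stDist y z := by
  unfold stDist
  rw [← Finset.sum_add_distrib]
  exact Finset.sum_le_sum fun j _ => abs_sub_le _ _ _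

theorem eq_of_stDist_eq_zero {x y : St n k} (h : stDist x y = 0) : x = y := by
  apply Subtype.ext
  funext j
  have := (Finset.sum_eq_zero_iff_of_nonneg fun _ _ => abs_nonneg _).1 h j (Finset.mem_univ j)
  exact_mod_cast sub_eq_zero.1 (abs_eq_zero.1 this)

/-- The `i`-th coordinate of a point of the star. -/
def coord (i : Fin n) (x : St n k) : ℕ := (x.1 i).toNat

theorem val_nonneg (x : St n k) (i : Fin n) : 0 ≤ x.1 i := by
  obtain ⟨j, h, h0, -⟩ := x.2
  by_cases hij : i = j
  · exact hij ▸ h0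
  · exact (h i hij).ge

theorem coord_cast (i : Fin n) (x : St n k) : (x.1 i : ℝ) = coord i x := by
  have : ((coord i x : ℕ) : ℤ) = x.1 i := Int.toNat_of_nonneg (val_nonneg x i)
  exact_mod_cast this.symm

/-- The point at distance `min m k` from the centre on the `i`-th branch. -/
def pt (k : ℕ) (i : Fin n) (m : ℕ) : St n k :=
  ⟨fun j => if j = i then (min m k : ℕ) else 0, i, fun j hj => if_neg hj, by simp,
    by simp⟩

theorem pt_zero (i j : Fin n) : pt k i 0 = pt k j 0 :=
  Subtype.ext (by funext l; simp [pt])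

theorem coord_pt_self (i : Fin n) {m : ℕ} (hm : m ≤ k) : coord i (pt k i m) = m := by
  simp [coord, pt, hm]

theorem coord_pt_of_ne {i j : Fin n} (h : j ≠ i) (m : ℕ) : coord j (pt k i m) = 0 := by
  simp [coord, pt, h]

theorem exists_eq_pt (x : St n k) : ∃ i, ∃ m ≤ k, x = pt k i m := by
  obtain ⟨i, h, h0, hk⟩ := x.2
  refine ⟨i, (x.1 i).toNat, by omega, Subtype.ext ?_⟩
  funext j
  by_cases hj : j = i
  · subst hj
    simp only [pt, if_true]
    omega
  · simp [pt, hj, h j hj]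

theorem coord_le (i : Fin n) (x : St n k) : coord i x ≤ k := by
  obtain ⟨j, m, hm, rfl⟩ := exists_eq_pt x
  by_cases h : i = j
  · subst h; rwa [coord_pt_self i hm]
  · simp [coord_pt_of_ne h]

theorem eq_pt_of_coord_pos {i : Fin n} {x : St n k} (h : 0 < coord i x) :
    x = pt k i (coord i x) := by
  obtain ⟨j, m, hm, rfl⟩ := exists_eq_pt x
  by_cases hij : i = j
  · subst hij; rw [coord_pt_self i hm]
  · simp [coord_pt_of_ne hij] at h

theorem stDist_eq (x y : St n k) : stDist x y = ∑ j, |(coord j x : ℝ) - coord j y| := by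
  simp only [stDist, coord_cast]

theorem stDist_pt (i : Fin n) {a b : ℕ} (ha : a ≤ k) (hb : b ≤ k) :
    stDist (pt k i a) (pt k i b) = |(a : ℝ) - b| := by
  rw [stDist_eq, Finset.sum_eq_single i]
  · rw [coord_pt_self i ha, coord_pt_self i hb]
  · intro j _ hj
    simp [coord_pt_of_ne hj]
  · simp

/-- The folding of the star onto a line that sends the `i`-th branch to the positive half-line
and the other branches to the negative half-line. -/
def fold (i : Fin n) (x : St n k) : ℝ := ∑ j, (if j = i then 1 else -1) * (coord j x : ℝ)

theorem fold_sub_le (i : Fin n) (x y : St n k) : |fold i x - fold i y| ≤ stDist x y := by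
  rw [fold, fold, ← Finset.sum_sub_distrib, stDist_eq]
  refine (Finset.abs_sum_le_sum_abs _ _).trans (Finset.sum_le_sum fun j _ => ?_)
  rw [← mul_sub, abs_mul]
  split_ifs <;> simp

theorem fold_pt_self (i : Fin n) {m : ℕ} (hm : m ≤ k) : fold i (pt k i m) = m := by
  rw [fold, Finset.sum_eq_single i]
  · simp [coord_pt_self i hm]
  · intro j _ hj
    simp [coord_pt_of_ne hj]
  · simp

theorem fold_of_coord_pos {i : Fin n} {x : St n k} (h : 0 < coord i x) :
    fold i x = coord i x := by
  conv_lhs => rw [eq_pt_of_coord_pos h]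
  exact fold_pt_self i (coord_le i x)

theorem fold_nonpos {i : Fin n} {x : St n k} (h : coord i x = 0) : fold i x ≤ 0 := by
  refine Finset.sum_nonpos fun j _ => ?_
  by_cases hj : j = i
  · simp [hj, h]
  · simp [hj]

theorem abs_fold_le (i : Fin n) (x : St n k) : |fold i x| ≤ k := by
  obtain ⟨j, m, hm, rfl⟩ := exists_eq_pt x
  have h := fold_sub_le i (pt k j m) (pt k j 0)
  rw [stDist_pt j hm (Nat.zero_le k), pt_zero j i, fold_pt_self i (Nat.zero_le k)] at h
  refine le_trans (by simpa using h) ?_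
  exact_mod_cast hm

/-- The nonnegative height functions obtained from the foldings and their negatives. -/
def foldHeight (i : Fin n) (b : Bool) (x : St n k) : ℝ≥0 :=
  (k + (if b then 1 else -1) * fold i x).toNNReal

theorem coe_foldHeight (i : Fin n) (b : Bool) (x : St n k) :
    (foldHeight i b x : ℝ) = k + (if b then 1 else -1) * fold i x := by
  refine Real.coe_toNNReal _ ?_
  have := abs_le.1 (abs_fold_le i x)
  cases b
  · simpa using this.2
  · have := this.1
    simp only [if_true, one_mul]
    linarith

theorem foldHeight_sub_le (i : Fin n) (b : Bool) (x y : St n k) :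
    (foldHeight i b x : ℝ) - foldHeight i b y ≤ stDist x y := by
  have h := abs_le.1 (fold_sub_le i x y)
  rw [coe_foldHeight, coe_foldHeight]
  cases b
  · simp only [Bool.false_eq_true, if_false]
    linarith [h.1]
  · simp only [if_true]
    linarith [h.2]

/-- The distance between the images of two lamplighter states in the two trees of a folding. -/
def foldDist (i : Fin n) (p q : Lamp (St n k)) : ℝ :=
  ∑ b, dist (lampPoint (foldHeight i b) p) (lampPoint (foldHeight i b) q)

theorem foldDist_le (i : Fin n) (p q : Lamp (St n k)) :
    foldDist i p q ≤ 4 * dLa stDist p q := by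
  have h b := dist_lampPoint_le stDist_nonneg stDist_self stDist_comm stDist_triangle
    (foldHeight i b) (foldHeight_sub_le i b) p q
  rw [foldDist, Fintype.sum_bool]
  linarith [h true, h false]

theorem foldDist_nonneg (i : Fin n) (p q : Lamp (St n k)) : 0 ≤ foldDist i p q :=
  Finset.sum_nonneg fun _ _ => dist_nonneg

/-- The positions and the modified lamps of two lamplighter states. -/
def relevant (p q : Lamp X) : Finset X := insert p.2 (insert q.2 (symmDiff p.1 q.1))

theorem le_foldDist (i : Fin n) {p q : Lamp (St n k)} {a b : St n k}
    (ha : a ∈ relevant p q) (hb : b ∈ relevant p q) :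
    2 * (fold i a - fold i b) ≤ foldDist i p q := by
  have h1 := le_dist_lampPoint_of_mem (foldHeight i true) ha
  have h2 := le_dist_lampPoint_of_mem (foldHeight i false) hb
  simp only [coe_foldHeight, if_true, Bool.false_eq_true, if_false] at h1 h2
  rw [foldDist, Fintype.sum_bool]
  linarith

theorem rho_le_foldDist (i : Fin n) (p q : Lamp (St n k)) : 4 * rho p q ≤ foldDist i p q := by
  by_cases h : p.1 = q.1
  · simpa [rho, h] using foldDist_nonneg i p q
  · obtain ⟨a, ha⟩ : (symmDiff p.1 q.1).Nonempty :=
      Finset.nonempty_iff_ne_empty.2 (by simpa [Finset.symmDiff_eq_empty] using h)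
    have h1 := le_dist_lampPoint (foldHeight i true) ha
    have h2 := le_dist_lampPoint (foldHeight i false) ha
    simp only [coe_foldHeight, if_true, Bool.false_eq_true, if_false] at h1 h2
    rw [foldDist, Fintype.sum_bool, rho, if_neg h]
    linarith

theorem tour_branch (i : Fin n) {a b : ℕ} (hab : a ≤ b) (hb : b ≤ k) :
    Tour stDist (pt k i a) (pt k i b) (pt k i '' Set.Icc a b) (b - a) := by
  induction b, hab using Nat.le_induction with
  | base => simpa using Tour.point (pt k i a)
  | succ b hab ih =>
    refine ((ih (by omega)).trans stDist_self (Tour.pair _ (pt k i (b + 1)))).mono ?_ ?_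
    · rintro _ ⟨m, ⟨h1, h2⟩, rfl⟩
      rcases h2.lt_or_eq with h | rfl
      · exact Or.inl ⟨m, ⟨h1, by omega⟩, rfl⟩
      · exact Or.inr (by simp)
    · rw [stDist_pt i (by omega) hb]
      push_cast
      rw [show (b : ℝ) - (b + 1) = -1 by ring, abs_neg, abs_one]
      linarith

/-- If all relevant points lie in one open branch, the salesman stays in their convex hull. -/
theorem TSP_le_of_forall_coord_pos {i : Fin n} {p q : Lamp (St n k)}
    (h : ∀ a ∈ relevant p q, 0 < coord i a) : TSP stDist p q ≤ 3 / 2 * foldDist i p q := by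
  have hne : (relevant p q).Nonempty := ⟨p.2, by simp [relevant]⟩
  obtain ⟨a, ha, hmin⟩ := (relevant p q).exists_min_image (coord i) hne
  obtain ⟨b, hb, hmax⟩ := (relevant p q).exists_max_image (coord i) hne
  have hx : p.2 ∈ relevant p q := by simp [relevant]
  have hy : q.2 ∈ relevant p q := by simp [relevant]
  have hd : ∀ u ∈ relevant p q, ∀ v ∈ relevant p q,
      stDist u v = |(coord i u : ℝ) - coord i v| := fun u hu v hv => by
    conv_lhs => rw [eq_pt_of_coord_pos (h u hu), eq_pt_of_coord_pos (h v hv)]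
    exact stDist_pt i (coord_le i u) (coord_le i v)
  have h1 : (coord i a : ℝ) ≤ coord i p.2 := mod_cast hmin _ hx
  have h2 : (coord i q.2 : ℝ) ≤ coord i b := mod_cast hmax _ hy
  have hR := le_foldDist i hb ha
  rw [fold_of_coord_pos (h a ha), fold_of_coord_pos (h b hb)] at hR
  have h3 : (coord i p.2 : ℝ) ≤ coord i b := mod_cast hmax _ hx
  have h4 : (coord i a : ℝ) ≤ coord i q.2 := mod_cast hmin _ hy
  have hmid := tour_branch i (hmin b hb) (coord_le i b)
  rw [← eq_pt_of_coord_pos (h a ha), ← eq_pt_of_coord_pos (h b hb)] at hmid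
  refine TSP_le_of_tour stDist_nonneg ((((Tour.pair p.2 a).trans stDist_self hmid).trans
    stDist_self (Tour.pair b q.2)).mono ?_ ?_)
  · intro c hc
    have hc' : c ∈ relevant p q :=
      Finset.mem_insert_of_mem (Finset.mem_insert_of_mem (Finset.mem_coe.1 hc))
    exact Or.inl (Or.inr ⟨coord i c, ⟨hmin c hc', hmax c hc'⟩, (eq_pt_of_coord_pos (h c hc')).symm⟩)
  · rw [hd _ hx _ ha, hd _ hb _ hy, abs_of_nonneg (by linarith), abs_of_nonneg (by linarith)]
    linarith

theorem tour_branches (i₀ : Fin n) {M : Fin n → ℕ} (hM : ∀ i, M i ≤ k) (s : Finset (Fin n)) :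
    Tour stDist (pt k i₀ 0) (pt k i₀ 0) (⋃ i ∈ s, pt k i '' Set.Icc 0 (M i))
      (∑ i ∈ s, 2 * (M i : ℝ)) := by
  induction s using Finset.induction_on with
  | empty => exact (Tour.point _).mono (by simp) (by simp)
  | insert i s hi ih =>
    have hout := tour_branch i (Nat.zero_le _) (hM i)
    have hback := Tour.pair (d := stDist) (pt k i (M i)) (pt k i 0)
    rw [stDist_pt i (hM i) (Nat.zero_le k), Nat.cast_zero, sub_zero, Nat.abs_cast] at hback
    have hloop := hout.trans stDist_self hback
    rw [pt_zero i i₀] at hloop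
    refine (hloop.trans stDist_self ih).mono ?_ ?_
    · rw [Finset.set_biUnion_insert]
      exact Set.union_subset_union_left _ Set.subset_union_left
    · rw [Finset.sum_insert hi]
      push_cast
      linarith

/-- If no open branch contains all relevant points, then the tour through the centre that
exhausts the branches one after another is efficient. -/
theorem TSP_le_of_forall_exists_coord_eq_zero (i₀ : Fin n) {p q : Lamp (St n k)}
    (h : ∀ i, ∃ b ∈ relevant p q, coord i b = 0) :
    TSP stDist p q ≤ 2 * ∑ i, foldDist i p q := by
  have hne : (relevant p q).Nonempty := ⟨p.2, by simp [relevant]⟩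
  have hmax i := (relevant p q).exists_max_image (coord i) hne
  choose a ha hmax using hmax
  have hR : ∀ i, 2 * (coord i (a i) : ℝ) ≤ foldDist i p q := fun i => by
    rcases Nat.eq_zero_or_pos (coord i (a i)) with h0 | h0
    · simpa [h0] using foldDist_nonneg i p q
    · obtain ⟨b, hb, hb0⟩ := h i
      have := le_foldDist i (ha i) hb
      rw [fold_of_coord_pos h0] at this
      linarith [fold_nonpos hb0]
  have hcenter : ∀ u ∈ relevant p q, stDist u (pt k i₀ 0) ≤ ∑ i, (coord i (a i) : ℝ) :=
    fun u hu => by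
      rw [stDist_eq]
      refine Finset.sum_le_sum fun i _ => ?_
      have h0 : coord i (pt k i₀ 0) = 0 := by
        rw [pt_zero i₀ i, coord_pt_self i (Nat.zero_le k)]
      rw [h0, Nat.cast_zero, sub_zero, Nat.abs_cast]
      exact_mod_cast hmax i u hu
  have hx := hcenter p.2 (by simp [relevant])
  have hy := hcenter q.2 (by simp [relevant])
  rw [stDist_comm] at hy
  refine TSP_le_of_tour stDist_nonneg ((((Tour.pair p.2 (pt k i₀ 0)).trans stDist_self
    (tour_branches i₀ (fun i => coord_le i (a i)) Finset.univ)).trans stDist_self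
    (Tour.pair (pt k i₀ 0) q.2)).mono ?_ ?_)
  · intro c hc
    have hc' : c ∈ relevant p q :=
      Finset.mem_insert_of_mem (Finset.mem_insert_of_mem (Finset.mem_coe.1 hc))
    obtain ⟨i, m, hm, rfl⟩ := exists_eq_pt c
    have := hmax i _ hc'
    rw [coord_pt_self i hm] at this
    exact Or.inl (Or.inr (Set.mem_biUnion (Finset.mem_coe.2 (Finset.mem_univ i))
      ⟨m, ⟨Nat.zero_le m, this⟩, rfl⟩))
  · have hsum := Finset.sum_le_sum fun i (_ : i ∈ Finset.univ) => hR i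
    rw [← Finset.mul_sum] at hsum ⊢
    linarith

theorem dLa_le_sum_foldDist (i₀ : Fin n) (p q : Lamp (St n k)) :
    dLa stDist p q ≤ 3 * ∑ i, foldDist i p q := by
  have hle : ∀ i, foldDist i p q ≤ ∑ i, foldDist i p q := fun i =>
    Finset.single_le_sum (fun j _ => foldDist_nonneg j p q) (Finset.mem_univ i)
  have hρ := rho_le_foldDist i₀ p q
  have hnn := (foldDist_nonneg i₀ p q).trans (hle i₀)
  have hTSP : TSP stDist p q ≤ 2 * ∑ i, foldDist i p q := by
    by_cases h : ∃ i, ∀ a ∈ relevant p q, 0 < coord i a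
    · obtain ⟨i, hi⟩ := h
      linarith [TSP_le_of_forall_coord_pos hi, hle i]
    · push Not at h
      exact TSP_le_of_forall_exists_coord_eq_zero i₀ fun i => by
        obtain ⟨b, hb, hb0⟩ := h i
        exact ⟨b, hb, by omega⟩
  unfold dLa
  linarith [hle i₀]

theorem eq_of_dLa_le_zero {p q : Lamp (St n k)} (h : dLa stDist p q ≤ 0) : p = q := by
  have hTSP := dist_le_TSP stDist_self stDist_triangle p q
  have hd := stDist_nonneg p.2 q.2
  unfold dLa rho at h
  split_ifs at h with hA
  · exact Prod.ext hA (eq_of_stDist_eq_zero (by linarith))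
  · linarith

end St

/-- The one-point space is an ℝ-tree. -/
theorem isRTree_of_subsingleton {T : Type*} [MetricSpace T] [Subsingleton T] : IsRTree T :=
  fun x y h => absurd (Subsingleton.elim x y) h

theorem two_mul_le_tree_count {n : ℕ} (hn : 1 ≤ n) : n * 2 ≤ 3 * (2 ^ n - 1) := by
  have : n + 1 ≤ 2 ^ n := Nat.lt_two_pow_self
  omega

/-- There is an absolute constant `c` such that for all `n, k ≥ 1`,
the lamplighter space `(La(St_{n,k}), d_La)` over the star graph `St_{n,k}` admits a
biLipschitz embedding with distortion at most `c·n` into an ℓ1-product of `3(2^n - 1)`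
ℝ-trees. -/
theorem statement13 :
    ∃ c : ℝ, 0 < c ∧ ∀ n k : ℕ, 1 ≤ n →
      ∃ (T : Fin (3 * (2 ^ n - 1)) → Type) (I : ∀ i, MetricSpace (T i)),
        (∀ i, @IsRTree (T i) (I i)) ∧
        ∃ f : Lamp (St n k) → ∀ i, T i,
          BiLipWith (dLa (stDist : St n k → St n k → ℝ)) (piL1Dist I) (c * n) f := by
  refine ⟨12, by norm_num, fun n k hn => ?_⟩
  have hcard : Fintype.card (Fin n × Bool) ≤ Fintype.card (Fin (3 * (2 ^ n - 1))) := by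
    simpa using two_mul_le_tree_count hn
  obtain ⟨e⟩ := Function.Embedding.nonempty_of_card_le hcard
  let δ (j : Fin n × Bool) (p q : Lamp (St n k)) : ℝ :=
    dist (lampPoint (St.foldHeight j.1 j.2) p) (lampPoint (St.foldHeight j.1 j.2) q)
  have htree : ∀ j, ∃ (T : Type) (_ : MetricSpace T) (f : Lamp (St n k) → T), IsRTree T ∧
      ∀ p q, dist (f p) (f q) = Function.extend e δ 0 j p q := by
    intro j
    by_cases hj : ∃ i, e i = j
    · obtain ⟨i, rfl⟩ := hj
      exact ⟨_, inferInstance, lampPoint (St.foldHeight i.1 i.2),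
        UltraCone.isRTree_separationQuotient, fun p q => by rw [e.injective.extend_apply]⟩
    · exact ⟨PUnit, inferInstance, fun _ => PUnit.unit, isRTree_of_subsingleton,
        fun p q => by rw [Function.extend_apply' _ _ _ hj]; simp⟩
  choose T I f hT hf using htree
  have hsum : ∀ p q, piL1Dist I (fun j => f j p) (fun j => f j q) =
      ∑ i, St.foldDist i p q := fun p q => by
    simp only [piL1Dist, hf, St.foldDist]
    rw [← Fintype.sum_prod_type' fun i b =>
      dist (lampPoint (St.foldHeight i b) p) (lampPoint (St.foldHeight i b) q)]
    symm
    refine Fintype.sum_of_injective e e.injective _ _ (fun j hj => ?_) fun i => ?_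
    · rw [Function.extend_apply' _ _ _ (by simpa using hj)]; rfl
    · rw [e.injective.extend_apply]
  have hlower := St.dLa_le_sum_foldDist (k := k) (⟨0, hn⟩ : Fin n)
  refine ⟨T, I, hT, fun p j => f j p, fun p q hpq => ?_, 1 / 3, by norm_num, fun p q => ?_⟩
  · apply St.eq_of_dLa_le_zero
    refine (hlower p q).trans ?_
    rw [← hsum, show (fun j => f j p) = fun j => f j q from hpq]
    simp [piL1Dist]
  · rw [hsum]
    refine ⟨by linarith [hlower p q], ?_⟩
    refine (Finset.sum_le_sum fun i _ => St.foldDist_le i p q).trans (le_of_eq ?_)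
    simp
    ring

end Lamplighter
end
end
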